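/- arXiv:1402.0747 — 3 statements merged into one kernel-verified Lean document; each statement's English description precedes it below -/
import Mathlib

section
/- Let ν > -1 be a real number and let j be any positive zero of the Bessel function J_ν. Then the sum, over all positive zeros y of J_ν with y ≠ j, of 1/(y² − j²) equals (ν + 1)/(2 j²). -/
/-- The Bessel function of the first kind of order `ν`, defined for `x > 0` by its series. -/
noncomputable def besselJ (ν x : ℝ) : ℝ :=
  ∑' m : ℕ, ((-1 : ℝ) ^ m / (m.factorial * Real.Gamma (m + ν + 1))) *
    (x / 2) ^ (2 * (m : ℝ) + ν)

theorem logDeriv_bound (g : ℂ → ℂ) (hg : Differentiable ℂ g) (R M : ℝ) (hM : 0 < M) (a : ℂ)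
    (ha : ‖a‖ + 1 < R) (hne : ∀ z ∈ Metric.ball (0:ℂ) R, g z ≠ 0)
    (hb : ∀ z ∈ Metric.ball (0:ℂ) R, ‖g z‖ ≤ ‖g 0‖ * Real.exp M) :
    ‖logDeriv g a‖ ≤ 2 * M * (‖a‖ + 1) / (R - (‖a‖ + 1)) := by
  have hR : 0 < R := by linarith [norm_nonneg a]
  have hd : DifferentiableOn ℂ (fun z => deriv g z / g z) (Metric.ball 0 R) := by
    apply DifferentiableOn.div _ hg.differentiableOn hne
    exact (hg.differentiableOn (s := Set.univ)).deriv isOpen_univ |>.mono (Set.subset_univ _)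
  obtain ⟨h, h0, hh⟩ := hd.isExactOn_ball.with_val_at 0 0
  have hexp : ∀ z ∈ Metric.ball (0:ℂ) R, g z = g 0 * Complex.exp (h z) := by
    intro z hz
    have hder : ∀ x ∈ Metric.ball (0:ℂ) R,
        HasDerivAt (fun z => g z * Complex.exp (-h z)) 0 x := by
      intro x hx
      have := (hg x).hasDerivAt.mul ((hh x hx).neg.cexp)
      refine this.congr_deriv ?_
      have := hne x hx
      field_simp
      ring
    have := (convex_ball (0:ℂ) R).is_const_of_fderivWithin_eq_zero (𝕜 := ℂ)
      (f := fun z => g z * Complex.exp (-h z))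
      (fun x hx => (hder x hx).differentiableAt.differentiableWithinAt)
      (fun x hx => by
        rw [fderivWithin_of_isOpen Metric.isOpen_ball hx]
        ext; simp [(hder x hx).deriv]) hz (Metric.mem_ball_self hR)
    simp only [h0, neg_zero, Complex.exp_zero, mul_one] at this
    rw [← this, mul_assoc, ← Complex.exp_add]; simp
  have hg0 : 0 < ‖g 0‖ := norm_pos_iff.2 (hne 0 (Metric.mem_ball_self hR))
  have hre : Set.MapsTo h (Metric.ball 0 R) {z | z.re ≤ M} := by
    intro z hz
    have h1 := hb z hz
    rw [hexp z hz, norm_mul, Complex.norm_exp] at h1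
    have h2 := le_of_mul_le_mul_left h1 hg0
    exact Real.exp_le_exp.1 h2
  have hhd : DifferentiableOn ℂ h (Metric.ball 0 R) := fun x hx =>
    (hh x hx).differentiableAt.differentiableWithinAt
  have hsub : Metric.closedBall a 1 ⊆ Metric.ball 0 R := by
    apply Metric.closedBall_subset_ball'
    rw [dist_zero_right]; linarith
  have haR : a ∈ Metric.ball (0:ℂ) R := hsub (Metric.mem_closedBall_self zero_le_one)
  have key := Complex.norm_deriv_le_of_forall_mem_sphere_norm_le (c := a) (R := 1) (f := h)
    (C := 2 * M * (‖a‖ + 1) / (R - (‖a‖ + 1))) one_pos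
    (hhd.diffContOnCl_ball hsub) (by
      intro z hz
      have hz' : ‖z‖ ≤ ‖a‖ + 1 := by
        have : ‖z - a‖ = 1 := by simpa [dist_eq_norm] using hz
        calc ‖z‖ = ‖a + (z - a)‖ := by ring_nf
          _ ≤ ‖a‖ + ‖z - a‖ := norm_add_le _ _
          _ = _ := by rw [this]
      refine (Complex.borelCaratheodory_zero hM hhd hre hR
        (hsub (Metric.sphere_subset_closedBall hz)) h0).trans ?_
      gcongr
      )
  rw [(hh a haR).deriv, div_one] at key
  simpa [logDeriv_apply] using key

theorem factor_entire (S : Finset ℂ) (f : ℂ → ℂ) (hf : Differentiable ℂ f)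
    (hS : ∀ s ∈ S, f s = 0) :
    ∃ g : ℂ → ℂ, Differentiable ℂ g ∧ ∀ z, f z = (∏ s ∈ S, (z - s)) * g z := by
  classical
  induction S using Finset.induction_on generalizing f with
  | empty => exact ⟨f, hf, by simp⟩
  | insert a S ha ih =>
    have hd : Differentiable ℂ (dslope f a) := by
      rw [← differentiableOn_univ, Complex.differentiableOn_dslope Filter.univ_mem]
      exact hf.differentiableOn
    have hfa : ∀ z, f z = (z - a) * dslope f a z := by
      intro z
      have := sub_smul_dslope f a z
      rw [hS a (Finset.mem_insert_self _ _), smul_eq_mul, sub_zero] at this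
      exact this.symm
    obtain ⟨g, hg, hfg⟩ := ih (dslope f a) hd (by
      intro s hs
      have h1 := hfa s
      rw [hS s (Finset.mem_insert_of_mem hs)] at h1
      rcases mul_eq_zero.1 h1.symm with h | h
      · exact absurd (sub_eq_zero.1 h ▸ hs) ha
      · exact h)
    refine ⟨g, hg, fun z => ?_⟩
    rw [hfa, hfg, Finset.prod_insert ha, mul_assoc]

theorem partial_fraction_at_zero (f : ℂ → ℂ) (hf : Differentiable ℂ f) (hf0 : f 0 ≠ 0)
    (hsimple : ∀ z, f z = 0 → deriv f z ≠ 0)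
    (hgrow : ∀ ε > (0:ℝ), ∃ C, ∀ z, ‖f z‖ ≤ C * Real.exp (ε * ‖z‖))
    (a : ℂ) (ha : f a = 0) (ε : ℝ) (hε : 0 < ε) :
    ∃ R₀, ∀ R ≥ R₀, ∀ S : Finset ℂ, (∀ z, z ∈ S ↔ f z = 0 ∧ ‖z‖ ≤ R ∧ z ≠ a) →
      ‖∑ s ∈ S, 1 / (a - s) - deriv (deriv f) a / (2 * deriv f a)‖ ≤ ε := by
  set ρ := ‖a‖ + 1 with hρ
  have hρ0 : 0 < ρ := by positivity
  -- choose growth rate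
  obtain ⟨C, hC⟩ := hgrow (ε / (16 * ρ)) (by positivity)
  have hf0' : 0 < ‖f 0‖ := norm_pos_iff.2 hf0
  have hCpos : 0 < C := by
    have := hC 0
    simp at this
    linarith
  set L := |Real.log (C / ‖f 0‖)| with hL
  -- M = L + 1 + 2 * ε' * R
  refine ⟨max (2 * ρ) (8 * ρ * (L + 1) / ε), fun R hR S hS => ?_⟩
  have hR1 : 2 * ρ ≤ R := (le_max_left _ _).trans hR
  have hR2 : 8 * ρ * (L + 1) / ε ≤ R := (le_max_right _ _).trans hR
  have hRpos : 0 < R := by linarith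
  have haS : a ∉ S := fun h => ((hS a).1 h).2.2 rfl
  obtain ⟨g, hg, hfg⟩ := factor_entire (insert a S) f hf (by
    intro s hs
    rcases Finset.mem_insert.1 hs with rfl | hs
    · exact ha
    · exact ((hS s).1 hs).1)
  have hmem : ∀ z, z ∈ insert a S ↔ f z = 0 ∧ ‖z‖ ≤ R := by
    intro z
    rw [Finset.mem_insert, hS]
    constructor
    · rintro (rfl | h)
      · exact ⟨ha, by linarith⟩
      · exact ⟨h.1, h.2.1⟩
    · rintro ⟨h1, h2⟩
      by_cases h : z = a
      · exact Or.inl h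
      · exact Or.inr ⟨h1, h2, h⟩
  have hgne : ∀ z, ‖z‖ ≤ R → g z ≠ 0 := by
    intro z hz hgz
    have hfz : f z = 0 := by rw [hfg, hgz, mul_zero]
    have hzS := (hmem z).2 ⟨hfz, hz⟩
    apply hsimple z hfz
    have hd1 : HasDerivAt (fun w => ∏ s ∈ insert a S, (w - s))
        (deriv (fun w => ∏ s ∈ insert a S, (w - s)) z) z :=
      DifferentiableAt.hasDerivAt (by fun_prop)
    have := hd1.mul (hg z).hasDerivAt
    have hfe : f = fun w => (∏ s ∈ insert a S, (w - s)) * g w := funext hfg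
    rw [hfe]
    refine this.deriv.trans ?_
    rw [hgz, Finset.prod_eq_zero hzS (sub_self z)]
    simp
  set M := L + 1 + ε / (16 * ρ) * (2 * R) with hM
  have hMpos : 0 < M := by positivity
  have hbound : ∀ z ∈ Metric.ball (0:ℂ) R, ‖g z‖ ≤ ‖g 0‖ * Real.exp M := by
    intro z hz
    refine Complex.norm_le_of_forall_mem_frontier_norm_le (U := Metric.ball 0 (2 * R))
      Metric.isBounded_ball hg.diffContOnCl (fun w hw => ?_)
      (subset_closure (Metric.ball_subset_ball (by linarith) hz))
    rw [frontier_ball _ (by positivity)] at hw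
    have hw : ‖w‖ = 2 * R := by simpa using hw
    have hP : ∏ s ∈ insert a S, ‖s‖ ≤ ∏ s ∈ insert a S, ‖w - s‖ := by
      apply Finset.prod_le_prod (fun _ _ => norm_nonneg _)
      intro s hs
      have h1 := ((hmem s).1 hs).2
      have h2 := norm_sub_norm_le w s
      linarith
    have hPpos : 0 < ∏ s ∈ insert a S, ‖s‖ := by
      apply Finset.prod_pos
      intro s hs
      rw [norm_pos_iff]
      rintro rfl
      exact hf0 ((hmem 0).1 hs).1
    have hf0e : ‖f 0‖ = (∏ s ∈ insert a S, ‖s‖) * ‖g 0‖ := by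
      rw [hfg, norm_mul, norm_prod]; simp
    have hfwe : ‖f w‖ = (∏ s ∈ insert a S, ‖w - s‖) * ‖g w‖ := by
      rw [hfg, norm_mul, norm_prod]
    have hfw : ‖f w‖ ≤ ‖f 0‖ * Real.exp M := by
      refine (hC w).trans ?_
      rw [hw, hM, Real.exp_add, ← mul_assoc (‖f 0‖)]
      refine mul_le_mul_of_nonneg_right ?_ (Real.exp_pos _).le
      rw [← div_le_iff₀' hf0']
      calc C / ‖f 0‖ = Real.exp (Real.log (C / ‖f 0‖)) := (Real.exp_log (by positivity)).symm
        _ ≤ _ := by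
          apply Real.exp_le_exp.2
          linarith [le_abs_self (Real.log (C / ‖f 0‖))]
    rw [hfwe, hf0e] at hfw
    have : (∏ s ∈ insert a S, ‖s‖) * ‖g w‖ ≤ (∏ s ∈ insert a S, ‖s‖) * (‖g 0‖ * Real.exp M) := by
      rw [← mul_assoc]
      exact (mul_le_mul_of_nonneg_right hP (norm_nonneg _)).trans hfw
    exact le_of_mul_le_mul_left this hPpos
  have hlog := logDeriv_bound g hg R M hMpos a (by linarith)
    (fun z hz => hgne z (by simpa using (Metric.mem_ball.1 hz).le)) hbound
  -- compute
  set q : ℂ → ℂ := fun z => (∏ s ∈ S, (z - s)) * g z with hq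
  have hqd : Differentiable ℂ q := by fun_prop
  have hfq : f = fun z => (z - a) * q z := by
    funext z; rw [hfg, Finset.prod_insert haS, mul_assoc]
  have hdf : deriv f = fun z => q z + (z - a) * deriv q z := by
    funext z
    have := ((hasDerivAt_id z).sub_const a).mul (hqd z).hasDerivAt
    rw [hfq]
    refine this.deriv.trans ?_
    simp
  have hqd' : Differentiable ℂ (deriv q) := by
    rw [← differentiableOn_univ]
    exact (hqd.differentiableOn (s := Set.univ)).deriv isOpen_univ
  have hddf : deriv (deriv f) a = 2 * deriv q a := by
    rw [hdf]
    have := (hqd a).hasDerivAt.add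
      (((hasDerivAt_id a).sub_const a).mul (hqd' a).hasDerivAt)
    refine this.deriv.trans ?_
    simp; ring
  have hdfa : deriv f a = q a := by rw [hdf]; simp
  have hsne : ∀ s ∈ S, a - s ≠ 0 := by
    intro s hs h
    exact haS (sub_eq_zero.1 h ▸ hs)
  have hld : logDeriv q a = ∑ s ∈ S, 1 / (a - s) + logDeriv g a := by
    rw [hq, logDeriv_mul a (Finset.prod_ne_zero_iff.2 hsne) (hgne a (by linarith)) (by fun_prop) (hg a),
      logDeriv_prod hsne (fun _ _ => by fun_prop)]
    congr 1
    apply Finset.sum_congr rfl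
    intro s hs
    simp [logDeriv_apply]
  have heq : ∑ s ∈ S, 1 / (a - s) - deriv (deriv f) a / (2 * deriv f a) = - logDeriv g a := by
    rw [hddf, hdfa, mul_div_mul_left _ _ two_ne_zero, ← logDeriv_apply, hld]; ring
  rw [heq, norm_neg]
  refine hlog.trans ?_
  rw [div_le_iff₀ (by linarith)]
  have e1 : 8 * ρ * (L + 1) ≤ ε * R := by
    rw [div_le_iff₀ hε] at hR2; linarith
  have e2 : ε / (16 * ρ) * (2 * R) * ρ = ε * R / 8 := by field_simp; ring
  have e3 : ε * (2 * ρ) ≤ ε * R := mul_le_mul_of_nonneg_left hR1 hε.le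
  calc 2 * M * ρ = 2 * (L + 1) * ρ + 2 * (ε / (16 * ρ) * (2 * R) * ρ) := by rw [hM]; ring
    _ ≤ ε * (R - ρ) := by rw [e2]; nlinarith

/-- Coefficients. -/
noncomputable def bC (ν : ℝ) (m : ℕ) : ℝ := (-1 : ℝ) ^ m / (m.factorial * Real.Gamma (m + ν + 1))

/-- The entire function attached to the Bessel function. -/
noncomputable def bF (ν : ℝ) (z : ℂ) : ℂ := ∑' m : ℕ, (bC ν m : ℂ) * z ^ m

theorem gamma_pos' {ν : ℝ} (hν : -1 < ν) (m : ℕ) : 0 < Real.Gamma (m + ν + 1) :=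
  Real.Gamma_pos_of_pos (by have : (0:ℝ) ≤ m := Nat.cast_nonneg m; linarith)

theorem gamma_succ' {ν : ℝ} (hν : -1 < ν) (m : ℕ) :
    Real.Gamma (m + ν + 1 + 1) = (m + ν + 1) * Real.Gamma (m + ν + 1) :=
  Real.Gamma_add_one (by have : (0:ℝ) ≤ m := Nat.cast_nonneg m; linarith)

theorem coef_bound {ν : ℝ} (hν : -1 < ν) {ε : ℝ} (hε : 0 < ε) :
    ∃ C, ∀ m : ℕ, 1 / Real.Gamma (m + ν + 1) ≤ C * ε ^ m := by
  have hs : Summable (fun m : ℕ => 1 / (ε ^ m * Real.Gamma (m + ν + 1))) := by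
    apply summable_of_ratio_test_tendsto_lt_one (l := 0) one_pos
    · exact Filter.Eventually.of_forall fun m => by
        have := gamma_pos' hν m
        positivity
    · have h1 : Filter.Tendsto (fun n : ℕ => 1 / ε * ((n:ℝ) + (ν + 1))⁻¹) Filter.atTop (nhds 0) := by
        rw [← mul_zero (1 / ε)]
        apply Filter.Tendsto.const_mul
        apply Filter.Tendsto.inv_tendsto_atTop
        exact Filter.tendsto_atTop_add_const_right _ _ tendsto_natCast_atTop_atTop
      refine h1.congr fun n => ?_
      have h2 := gamma_pos' hν n
      have h3 := gamma_pos' hν (n+1)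
      have h4 : Real.Gamma ((n + 1 : ℕ) + ν + 1) = (n + ν + 1) * Real.Gamma (n + ν + 1) := by
        rw [← gamma_succ' hν n]; push_cast; ring_nf
      have h5 : 0 < (n:ℝ) + ν + 1 := by
        have : (0:ℝ) ≤ n := Nat.cast_nonneg n
        linarith
      rw [Real.norm_of_nonneg (by positivity), Real.norm_of_nonneg (by positivity), h4, pow_succ,
        ← add_assoc]
      field_simp
  refine ⟨∑' m : ℕ, 1 / (ε ^ m * Real.Gamma (m + ν + 1)), fun m => ?_⟩
  have := hs.le_tsum m (fun k _ => by
    have := gamma_pos' hν k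
    positivity)
  rw [← div_le_iff₀ (by positivity)]
  refine le_trans (le_of_eq ?_) this
  rw [div_div, mul_comm]

theorem term_bound {ν : ℝ} (hν : -1 < ν) {ε : ℝ} (hε : 0 < ε) :
    ∃ C, ∀ (m : ℕ) (z : ℂ), ‖(bC ν m : ℂ) * z ^ m‖ ≤ C * ((ε * ‖z‖) ^ m / m.factorial) := by
  obtain ⟨C, hC⟩ := coef_bound hν hε
  refine ⟨C, fun m z => ?_⟩
  have h2 := gamma_pos' hν m
  have h0 : ‖(bC ν m : ℂ)‖ = 1 / Real.Gamma (m + ν + 1) / m.factorial := by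
    rw [Complex.norm_real, bC, norm_div, norm_pow, norm_mul, norm_neg, norm_one, one_pow,
      Real.norm_of_nonneg h2.le, Real.norm_of_nonneg (by positivity), div_div, mul_comm]
  rw [norm_mul, h0, norm_pow]
  calc _ ≤ C * ε ^ m / m.factorial * ‖z‖ ^ m := by gcongr; exact hC m
    _ = _ := by rw [mul_pow]; ring

theorem bF_hasSum {ν : ℝ} (hν : -1 < ν) (z : ℂ) :
    HasSum (fun m : ℕ => (bC ν m : ℂ) * z ^ m) (bF ν z) := by
  obtain ⟨C, hC⟩ := term_bound hν one_pos
  exact (Summable.of_norm_bounded ((Real.summable_pow_div_factorial _).mul_left C)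
    (fun m => hC m z)).hasSum

theorem bF_growth {ν : ℝ} (hν : -1 < ν) (ε : ℝ) (hε : 0 < ε) :
    ∃ C, ∀ z, ‖bF ν z‖ ≤ C * Real.exp (ε * ‖z‖) := by
  obtain ⟨C, hC⟩ := term_bound hν hε
  refine ⟨C, fun z => ?_⟩
  have h1 : HasSum (fun m : ℕ => (ε * ‖z‖) ^ m / m.factorial) (Real.exp (ε * ‖z‖)) := by
    rw [Real.exp_eq_exp_ℝ]
    exact NormedSpace.expSeries_div_hasSum_exp (ε * ‖z‖)
  exact tsum_of_norm_bounded (h1.mul_left C) (fun m => hC m z)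

theorem bC_succ {ν : ℝ} (hν : -1 < ν) (m : ℕ) :
    ((m:ℝ) + 1) * bC ν (m + 1) = - bC (ν + 1) m := by
  have h3 := gamma_pos' hν (m+1)
  have h4 : Real.Gamma (m + (ν + 1) + 1) = Real.Gamma ((m + 1 : ℕ) + ν + 1) := by
    push_cast; ring_nf
  rw [bC, bC, h4, Nat.factorial_succ, pow_succ]
  push_cast at h3 ⊢
  field_simp

theorem bF_hasDerivAt {ν : ℝ} (hν : -1 < ν) (z : ℂ) : HasDerivAt (bF ν) (- bF (ν + 1) z) z := by
  obtain ⟨C, hC⟩ := term_bound hν one_pos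
  have hCpos : 0 ≤ C := by
    have := (norm_nonneg _).trans (hC 0 0)
    simpa using this
  have hu : Summable (fun m : ℕ => C * ((1 * (‖z‖ + 1)) ^ m / m.factorial)) :=
    (Real.summable_pow_div_factorial _).mul_left C
  have hz : z ∈ Metric.ball (0:ℂ) (‖z‖ + 1) := by simp
  have hF : ∀ (i : ℕ) (w : ℂ), w ∈ Metric.ball (0:ℂ) (‖z‖ + 1) →
      ‖(bC ν i : ℂ) * w ^ i‖ ≤ C * ((1 * (‖z‖ + 1)) ^ i / i.factorial) := by
    intro i w hw
    have : ‖w‖ ≤ ‖z‖ + 1 := by simpa using (Metric.mem_ball.1 hw).le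
    refine (hC i w).trans ?_
    gcongr
  have hd : ∀ i : ℕ, DifferentiableOn ℂ (fun w : ℂ => (bC ν i : ℂ) * w ^ i)
      (Metric.ball (0:ℂ) (‖z‖ + 1)) := fun i => by fun_prop
  have h1 := Complex.differentiableOn_tsum_of_summable_norm hu hd Metric.isOpen_ball hF
  have h2 := Complex.hasSum_deriv_of_summable_norm hu hd Metric.isOpen_ball hF hz
  have h3 : HasDerivAt (bF ν) (deriv (bF ν) z) z :=
    (h1.differentiableAt (Metric.isOpen_ball.mem_nhds hz)).hasDerivAt
  refine h3.congr_deriv ?_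
  refine HasSum.unique h2 ?_
  rw [← hasSum_nat_add_iff' 1]
  convert! (bF_hasSum (by linarith : -1 < ν + 1) z).neg using 1
  · funext m
    have := bC_succ hν m
    have h' : ((m:ℂ) + 1) * (bC ν (m + 1) : ℂ) = - (bC (ν + 1) m : ℂ) := by exact_mod_cast this
    refine (((hasDerivAt_pow (m + 1) z).const_mul (bC ν (m + 1) : ℂ)).deriv).trans ?_
    rw [← neg_mul, ← h']
    push_cast
    ring
  · simp

theorem bF_differentiable {ν : ℝ} (hν : -1 < ν) : Differentiable ℂ (bF ν) := fun z =>
  (bF_hasDerivAt hν z).differentiableAt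

theorem bF_deriv {ν : ℝ} (hν : -1 < ν) : deriv (bF ν) = fun z => - bF (ν + 1) z :=
  funext fun z => (bF_hasDerivAt hν z).deriv

theorem bF_zero {ν : ℝ} (hν : -1 < ν) : bF ν 0 ≠ 0 := by
  have h : HasSum (fun m : ℕ => (bC ν m : ℂ) * 0 ^ m) (bC ν 0 : ℂ) := by
    convert! hasSum_single (f := fun m : ℕ => (bC ν m : ℂ) * 0 ^ m) 0 ?_ using 1
    · simp
    · intro m hm; simp [hm]
  rw [(bF_hasSum hν 0).unique h]
  have := gamma_pos' hν 0
  have h2 : bC ν 0 ≠ 0 := by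
    rw [bC]; positivity
  exact_mod_cast h2

theorem bC_rec {ν : ℝ} (hν : -1 < ν) (m : ℕ) :
    bC ν m = (ν + 1) * bC (ν + 1) m + m * bC (ν + 1) m := by
  have h3 := gamma_pos' hν m
  have h5 : 0 < (m:ℝ) + ν + 1 := by
    have : (0:ℝ) ≤ m := Nat.cast_nonneg m
    linarith
  have h4 : Real.Gamma (m + (ν + 1) + 1) = (m + ν + 1) * Real.Gamma (m + ν + 1) := by
    rw [← gamma_succ' hν m]; ring_nf
  rw [bC, bC, h4]
  field_simp
  ring

theorem bF_rec {ν : ℝ} (hν : -1 < ν) (z : ℂ) :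
    z * bF (ν + 2) z = (ν + 1) * bF (ν + 1) z - bF ν z := by
  have hν1 : -1 < ν + 1 := by linarith
  have h1 : HasSum (fun m : ℕ => -((m : ℂ) * (bC (ν + 1) m : ℂ) * z ^ m)) (z * bF (ν + 2) z) := by
    rw [← hasSum_nat_add_iff' 1]
    convert! (bF_hasSum (by linarith : -1 < ν + 2) z).mul_left z using 1
    · funext m
      have := bC_succ hν1 m
      rw [show ν + 1 + 1 = ν + 2 by ring] at this
      have h' : ((m:ℂ) + 1) * (bC (ν + 1) (m + 1) : ℂ) = - (bC (ν + 2) m : ℂ) := by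
        exact_mod_cast this
      push_cast
      rw [h', pow_succ]; ring
    · simp
  have h2 := ((bF_hasSum hν1 z).mul_left ((ν:ℂ) + 1)).sub (bF_hasSum hν z)
  refine h1.unique ?_
  convert! h2 using 1
  funext m
  have : (bC ν m : ℂ) = (ν + 1) * bC (ν + 1) m + m * bC (ν + 1) m := by exact_mod_cast bC_rec hν m
  rw [this]; ring

theorem bF_iter {ν : ℝ} (hν : -1 < ν) (n : ℕ) :
    iteratedDeriv n (bF ν) = fun z => (-1) ^ n * bF (ν + n) z := by
  induction n with
  | zero => simp
  | succ n ih =>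
    rw [iteratedDeriv_succ, ih]
    funext z
    have hn : -1 < ν + n := by
      have : (0:ℝ) ≤ n := Nat.cast_nonneg n
      linarith
    rw [((bF_hasDerivAt hn z).const_mul ((-1 : ℂ) ^ n)).deriv]
    push_cast
    rw [← add_assoc]; ring

theorem bF_simple {ν : ℝ} (hν : -1 < ν) (a : ℂ) (h : bF ν a = 0) : deriv (bF ν) a ≠ 0 := by
  intro h'
  have ha : a ≠ 0 := by
    rintro rfl; exact bF_zero hν h
  rw [bF_deriv hν] at h'
  have h1 : bF (ν + 1) a = 0 := by simpa using h'
  have hall : ∀ n : ℕ, bF (ν + n) a = 0 ∧ bF (ν + n + 1) a = 0 := by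
    intro n
    induction n with
    | zero => simpa using ⟨h, h1⟩
    | succ n ih =>
      have hn : -1 < ν + n := by
        have : (0:ℝ) ≤ n := Nat.cast_nonneg n
        linarith
      have := bF_rec hn a
      rw [ih.1, ih.2] at this
      simp [ha] at this
      push_cast
      rw [← add_assoc]
      refine ⟨ih.2, ?_⟩
      rw [show ν + n + 1 + 1 = ν + n + 2 by ring]
      exact this
  have := Complex.taylorSeries_eq_of_entire (bF_differentiable hν) a 0
  simp only [bF_iter hν, (hall _).1] at this
  simp at this
  exact bF_zero hν this.symm

theorem const_of_deriv_nonneg (H k : ℝ → ℝ) (hc : Continuous H) (h0 : H 0 = 0) (h1 : H 1 = 0)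
    (hd : ∀ t ∈ Set.Ioo (0:ℝ) 1, HasDerivAt H (k t) t) (hk : ∀ t ∈ Set.Ioo (0:ℝ) 1, 0 ≤ k t) :
    ∀ t ∈ Set.Ioo (0:ℝ) 1, k t = 0 := by
  have hm : MonotoneOn H (Set.Icc 0 1) := by
    apply monotoneOn_of_deriv_nonneg (convex_Icc 0 1) hc.continuousOn
    · rw [interior_Icc]
      exact fun t ht => (hd t ht).differentiableAt.differentiableWithinAt
    · rw [interior_Icc]
      intro t ht
      rw [(hd t ht).deriv]; exact hk t ht
  have hz : ∀ t ∈ Set.Icc (0:ℝ) 1, H t = 0 := by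
    intro t ht
    have e1 := hm (by simp) ht ht.1
    have e2 := hm ht (by simp) ht.2
    linarith
  intro t ht
  have hev : H =ᶠ[nhds t] fun _ => 0 := by
    filter_upwards [Ioo_mem_nhds ht.1 ht.2] with s hs
    exact hz s ⟨hs.1.le, hs.2.le⟩
  exact ((hd t ht).unique ((hasDerivAt_const t (0:ℝ)).congr_of_eventuallyEq hev))

theorem bF_not_all_zero {ν : ℝ} (hν : -1 < ν) (a : ℂ)
    (h : ∀ t ∈ Set.Ioo (0:ℝ) 1, bF ν (a * t) = 0) : False := by
  have hcl : IsClosed {t : ℝ | bF ν (a * t) = 0} := by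
    have : Continuous (fun t : ℝ => bF ν (a * t)) :=
      (bF_differentiable hν).continuous.comp (by fun_prop)
    exact isClosed_eq this continuous_const
  have := hcl.closure_subset_iff.2 (show Set.Ioo (0:ℝ) 1 ⊆ _ from h)
  rw [closure_Ioo (by norm_num)] at this
  have h0 : bF ν (a * (0:ℝ)) = 0 := this (show (0:ℝ) ∈ Set.Icc (0:ℝ) 1 by simp)
  simp at h0
  exact bF_zero hν h0

/-- the auxiliary function -/
noncomputable def bG (ν : ℝ) (a : ℂ) (t : ℝ) : ℂ :=
  ((t ^ (ν + 1) : ℝ) : ℂ) * (bF (ν + 1) (a * t) * (starRingEnd ℂ) (bF ν (a * t)))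

theorem bG_continuous {ν : ℝ} (hν : -1 < ν) (a : ℂ) : Continuous (bG ν a) := by
  have h1 : Continuous (fun t : ℝ => bF ν (a * t)) :=
      (bF_differentiable hν).continuous.comp (by fun_prop)
  have h2 : Continuous (fun t : ℝ => bF (ν + 1) (a * t)) :=
      (bF_differentiable (by linarith : -1 < ν + 1)).continuous.comp (by fun_prop)
  have h3 : Continuous (fun t : ℝ => t ^ (ν + 1)) := Real.continuous_rpow_const (by linarith)
  unfold bG
  exact (Complex.continuous_ofReal.comp h3).mul (h2.mul (Complex.continuous_conj.comp h1))

theorem bG_deriv {ν : ℝ} (hν : -1 < ν) (a : ℂ) (t : ℝ) (ht : 0 < t) :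
    HasDerivAt (bG ν a) (((t ^ ν * Complex.normSq (bF ν (a * t)) : ℝ) : ℂ)
      - (starRingEnd ℂ) a * ((t ^ (ν + 1) * Complex.normSq (bF (ν + 1) (a * t)) : ℝ) : ℂ)) t := by
  have hν1 : -1 < ν + 1 := by linarith
  have hr : HasDerivAt (fun t : ℝ => ((t ^ (ν + 1) : ℝ) : ℂ)) (((ν + 1) * t ^ ν : ℝ) : ℂ) t := by
    have := (Real.hasDerivAt_rpow_const (x := t) (p := ν + 1) (Or.inl ht.ne')).ofReal_comp
    simpa using this
  have hlin : HasDerivAt (fun s : ℂ => a * s) a (t : ℂ) := by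
    simpa using (hasDerivAt_id (t:ℂ)).const_mul a
  have hp : HasDerivAt (fun t : ℝ => bF ν (a * t)) (- bF (ν + 1) (a * t) * a) t :=
    (HasDerivAt.comp (t:ℂ) (bF_hasDerivAt hν (a * t)) hlin).comp_ofReal
  have hw : HasDerivAt (fun t : ℝ => bF (ν + 1) (a * t)) (- bF (ν + 1 + 1) (a * t) * a) t :=
    (HasDerivAt.comp (t:ℂ) (bF_hasDerivAt hν1 (a * t)) hlin).comp_ofReal
  have := hr.mul (hw.mul hp.star)
  refine this.congr_deriv ?_
  have hrec := bF_rec hν (a * t)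
  rw [show ν + 1 + 1 = ν + 2 by ring]
  have htp : t ^ (ν + 1) = t ^ ν * t := by
    rw [Real.rpow_add ht, Real.rpow_one]
  rw [htp]
  push_cast
  rw [Complex.normSq_eq_conj_mul_self, Complex.normSq_eq_conj_mul_self]
  simp only [← starRingEnd_apply, map_mul, map_neg, Pi.mul_apply]
  linear_combination (-(t ^ ν : ℝ) * (starRingEnd ℂ) (bF ν (a * t))) * hrec

theorem bF_zero_real {ν : ℝ} (hν : -1 < ν) (a : ℂ) (h : bF ν a = 0) : a.im = 0 ∧ 0 < a.re := by
  have hν1 : -1 < ν + 1 := by linarith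
  have hG0 : bG ν a 0 = 0 := by
    simp [bG, Real.zero_rpow (by linarith : ν + 1 ≠ 0)]
  have hG1 : bG ν a 1 = 0 := by simp [bG, h]
  have him : a.im = 0 := by
    by_contra hne
    have key := const_of_deriv_nonneg (fun t => a.im * (bG ν a t).im)
      (fun t => a.im ^ 2 * (t ^ (ν + 1) * Complex.normSq (bF (ν + 1) (a * t))))
      (continuous_const.mul (Complex.continuous_im.comp (bG_continuous hν a)))
      (by simp [hG0]) (by simp [hG1])
      (fun t ht => by
        have h1 := bG_deriv hν a t ht.1
        have h2 := (Complex.imCLM.hasFDerivAt.comp_hasDerivAt t h1).const_mul a.im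
        refine h2.congr_deriv ?_
        simp only [Complex.imCLM_apply, Complex.sub_im, Complex.ofReal_im, Complex.im_mul_ofReal,
          Complex.conj_im]
        ring)
      (fun t ht => by
        have := Complex.normSq_nonneg (bF (ν + 1) (a * t))
        have := ht.1
        positivity)
    refine bF_not_all_zero hν1 a fun t ht => ?_
    have h3 := key t ht
    have h4 : t ^ (ν + 1) ≠ 0 := (Real.rpow_pos_of_pos ht.1 _).ne'
    simpa [hne, h4] using h3
  refine ⟨him, ?_⟩
  by_contra hre
  push Not at hre
  have hterm : ∀ t ∈ Set.Ioo (0:ℝ) 1, 0 ≤ t ^ ν * Complex.normSq (bF ν (a * t)) ∧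
      0 ≤ (-a.re) * (t ^ (ν + 1) * Complex.normSq (bF (ν + 1) (a * t))) := by
    intro t ht
    have h0 := ht.1
    have h1 := Complex.normSq_nonneg (bF ν (a * t))
    have h2 := Complex.normSq_nonneg (bF (ν + 1) (a * t))
    have h3 : 0 ≤ -a.re := by linarith
    constructor <;> positivity
  have key := const_of_deriv_nonneg (fun t => (bG ν a t).re)
      (fun t => t ^ ν * Complex.normSq (bF ν (a * t)) +
        (-a.re) * (t ^ (ν + 1) * Complex.normSq (bF (ν + 1) (a * t))))
      (Complex.continuous_re.comp (bG_continuous hν a))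
      (by simp [hG0]) (by simp [hG1])
      (fun t ht => by
        have h1 := bG_deriv hν a t ht.1
        have h2 := (Complex.reCLM.hasFDerivAt.comp_hasDerivAt t h1)
        refine h2.congr_deriv ?_
        simp only [Complex.reCLM_apply, Complex.sub_re, Complex.ofReal_re, Complex.re_mul_ofReal,
          Complex.conj_re]
        ring)
      (fun t ht => add_nonneg (hterm t ht).1 (hterm t ht).2)
  refine bF_not_all_zero hν a fun t ht => ?_
  have h3 := key t ht
  have h4 : t ^ ν ≠ 0 := (Real.rpow_pos_of_pos ht.1 _).ne'
  have h5 : t ^ ν * Complex.normSq (bF ν (a * t)) = 0 := by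
    have := hterm t ht
    linarith [this.1, this.2]
  simpa [h4] using h5

theorem bF_zeros_finite {ν : ℝ} (hν : -1 < ν) (R : ℝ) : {z : ℂ | bF ν z = 0 ∧ ‖z‖ ≤ R}.Finite := by
  by_contra hinf
  obtain ⟨x, -, hx⟩ := Set.Infinite.exists_accPt_of_subset_isCompact hinf
    (isCompact_closedBall (0:ℂ) R) (fun z hz => by simpa using hz.2)
  have hfr : ∃ᶠ z in nhdsWithin x {x}ᶜ, bF ν z = (fun _ => (0:ℂ)) z :=
    (accPt_iff_frequently_nhdsNE.1 hx).mono fun z hz => hz.1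
  have := AnalyticOnNhd.eq_of_frequently_eq (f := bF ν) (g := fun _ => 0)
    (fun z _ => (bF_differentiable hν).analyticAt z) (fun z _ => analyticAt_const) hfr
  exact bF_zero hν (congrFun this 0)

theorem besselJ_eq {ν : ℝ} (y : ℝ) (hy : 0 < y) :
    (besselJ ν y : ℂ) = (((y / 2) ^ ν : ℝ) : ℂ) * bF ν ((y ^ 2 / 4 : ℝ) : ℂ) := by
  rw [besselJ, bF, ← tsum_mul_left, Complex.ofReal_tsum]
  congr 1
  funext m
  have h : (y / 2) ^ (2 * (m : ℝ) + ν) = (y / 2) ^ ν * (y ^ 2 / 4) ^ m := by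
    rw [Real.rpow_add (by positivity), Real.rpow_mul (by positivity), Real.rpow_natCast]
    norm_num
    rw [div_pow y 2 2]; norm_num; ring
  rw [h, bC]
  push_cast
  ring

theorem besselJ_zero_iff {ν : ℝ} (y : ℝ) (hy : 0 < y) :
    besselJ ν y = 0 ↔ bF ν ((y ^ 2 / 4 : ℝ) : ℂ) = 0 := by
  rw [← Complex.ofReal_eq_zero, besselJ_eq y hy, mul_eq_zero, Complex.ofReal_eq_zero]
  have : (y / 2) ^ ν ≠ 0 := (Real.rpow_pos_of_pos (by positivity) _).ne'
  simp [this]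

theorem calogero_identity (ν : ℝ) (hν : -1 < ν) (j : ℝ) (hj : 0 < j)
    (hjz : besselJ ν j = 0) :
    ∑' y : {y : ℝ // 0 < y ∧ besselJ ν y = 0 ∧ y ≠ j},
      (1 : ℝ) / ((y : ℝ) ^ 2 - j ^ 2) = (ν + 1) / (2 * j ^ 2) := by
  classical
  set ι := {y : ℝ // 0 < y ∧ besselJ ν y = 0 ∧ y ≠ j} with hι
  have hν1 : -1 < ν + 1 := by linarith
  let φ : ι → ℂ := fun y => (((y : ℝ) ^ 2 / 4 : ℝ) : ℂ)
  set a : ℂ := ((j ^ 2 / 4 : ℝ) : ℂ) with ha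
  have hfa : bF ν a = 0 := (besselJ_zero_iff j hj).1 hjz
  have ha0 : a ≠ 0 := by
    rw [ha, Complex.ofReal_ne_zero]; positivity
  have hsq : ∀ x y : ℝ, 0 < x → 0 < y → ((x ^ 2 / 4 : ℝ) : ℂ) = ((y ^ 2 / 4 : ℝ) : ℂ) → x = y := by
    intro x y hx hy h
    have h' : x ^ 2 / 4 = y ^ 2 / 4 := by exact_mod_cast h
    have h2 : x ^ 2 = y ^ 2 := by linarith
    exact (pow_left_inj₀ hx.le hy.le two_ne_zero).1 h2
  have hφ : Function.Injective φ := fun x y h => Subtype.ext (hsq x y x.2.1 y.2.1 h)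
  have hφz : ∀ y : ι, bF ν (φ y) = 0 := fun y => (besselJ_zero_iff y y.2.1).1 y.2.2.1
  have hφn : ∀ y : ι, ‖φ y‖ = (y : ℝ) ^ 2 / 4 := fun y => by
    simp only [φ]
    rw [Complex.norm_real, Real.norm_of_nonneg (by positivity)]
  have hφa : ∀ y : ι, φ y ≠ a := fun y h => y.2.2.2 (hsq y j y.2.1 hj h)
  have hφs : ∀ z, bF ν z = 0 → z ≠ a → ∃ y : ι, φ y = z := by
    intro z hz hza
    obtain ⟨h1, h2⟩ := bF_zero_real hν z hz
    have h3 : (((2 * Real.sqrt z.re) ^ 2 / 4 : ℝ) : ℂ) = z := by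
      rw [mul_pow, Real.sq_sqrt h2.le]
      apply Complex.ext
      · rw [Complex.ofReal_re]; ring
      · rw [Complex.ofReal_im, h1]
    have hpos : 0 < 2 * Real.sqrt z.re := by have := Real.sqrt_pos.2 h2; positivity
    refine ⟨⟨2 * Real.sqrt z.re, hpos, (besselJ_zero_iff _ hpos).2 (by rw [h3]; exact hz), ?_⟩, h3⟩
    intro h
    rw [h] at h3
    exact hza h3.symm
  have hfin : ∀ R : ℝ, {y : ι | ‖φ y‖ ≤ R}.Finite := by
    intro R
    refine Set.Finite.of_finite_image ((bF_zeros_finite hν R).subset ?_) hφ.injOn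
    rintro _ ⟨y, hy, rfl⟩
    exact ⟨hφz y, hy⟩
  let T : ℝ → Finset ι := fun R => (hfin R).toFinset
  have hT : ∀ R y, y ∈ T R ↔ ‖φ y‖ ≤ R := fun R y => by simp [T]
  have hratio : deriv (deriv (bF ν)) a / (2 * deriv (bF ν) a) = - ((ν + 1) / (2 * a)) := by
    have hs := bF_simple hν a hfa
    have hd := bF_deriv hν
    have hdd : deriv (deriv (bF ν)) a = bF (ν + 2) a := by
      rw [hd]
      refine (bF_hasDerivAt hν1 a).neg.deriv.trans ?_
      rw [neg_neg, add_assoc]; norm_num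
    have hrec := bF_rec hν a
    rw [hfa, sub_zero] at hrec
    rw [hdd]
    rw [hd] at hs ⊢
    simp only at hs ⊢
    have hs' : bF (ν + 1) a ≠ 0 := fun h => hs (by rw [h, neg_zero])
    field_simp
    linear_combination -hrec
  set V := (ν + 1) / (2 * j ^ 2) with hV
  have happrox : ∀ ε > 0, ∃ R₀, ∀ R ≥ R₀,
      |∑ y ∈ T R, (1 : ℝ) / ((y : ℝ) ^ 2 - j ^ 2) - V| ≤ ε := by
    intro ε hε
    obtain ⟨R₀, hR₀⟩ := partial_fraction_at_zero (bF ν) (bF_differentiable hν) (bF_zero hν)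
      (fun z hz => bF_simple hν z hz) (fun ε hε => bF_growth hν ε hε) a hfa ε hε
    refine ⟨R₀, fun R hR => ?_⟩
    have h1 := hR₀ R hR ((T R).image φ) (by
      intro z
      rw [Finset.mem_image]
      constructor
      · rintro ⟨y, hy, rfl⟩
        exact ⟨hφz y, (hT R y).1 hy, hφa y⟩
      · rintro ⟨hz, hzR, hza⟩
        obtain ⟨y, rfl⟩ := hφs z hz hza
        exact ⟨y, (hT R y).2 hzR, rfl⟩)
    rw [hratio, Finset.sum_image (fun x _ y _ h => hφ h)] at h1
    have h2 : ∑ y ∈ T R, 1 / (a - φ y) - -((ν + 1) / (2 * a)) =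
        ((-4 * (∑ y ∈ T R, (1 : ℝ) / ((y : ℝ) ^ 2 - j ^ 2) - V) : ℝ) : ℂ) := by
      have e1 : ∀ y : ι, 1 / (a - φ y) = ((-4 * ((1 : ℝ) / ((y : ℝ) ^ 2 - j ^ 2)) : ℝ) : ℂ) := by
        intro y
        simp only [ha, φ]
        rw [← Complex.ofReal_sub, ← Complex.ofReal_one, ← Complex.ofReal_div]
        congr 1
        rw [show j ^ 2 / 4 - (y:ℝ) ^ 2 / 4 = -((y:ℝ) ^ 2 - j ^ 2) / 4 by ring, one_div_div, div_neg]
        ring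
      have e2 : ((ν : ℂ) + 1) / (2 * a) = ((4 * V : ℝ) : ℂ) := by
        rw [ha, hV]; push_cast
        have : (j : ℂ) ≠ 0 := by exact_mod_cast hj.ne'
        field_simp
      rw [Finset.sum_congr rfl (fun y _ => e1 y), e2, ← Complex.ofReal_sum, ← Finset.mul_sum]
      push_cast; ring
    rw [h2, Complex.norm_real, Real.norm_eq_abs, abs_mul] at h1
    norm_num at h1 ⊢
    linarith [abs_nonneg (∑ y ∈ T R, (((y : ℝ) ^ 2 - j ^ 2)⁻¹) - V)]
  apply HasSum.tsum_eq
  rw [HasSum, SummationFilter.unconditional_filter, Metric.tendsto_atTop]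
  intro ε hε
  obtain ⟨R₀, hR₀⟩ := happrox (ε / 2) (by positivity)
  set R₁ := max R₀ (j ^ 2 / 4) with hR₁
  refine ⟨T R₁, fun S hS => ?_⟩
  have hpos : ∀ y : ι, y ∉ T R₁ → 0 ≤ (1 : ℝ) / ((y : ℝ) ^ 2 - j ^ 2) := by
    intro y hy
    rw [hT, not_le, hφn] at hy
    have := (le_max_right _ _).trans_lt hy
    apply one_div_nonneg.2
    linarith
  obtain ⟨R₂, hR₂, hSR⟩ : ∃ R₂ ≥ R₁, S ⊆ T R₂ := by
    refine ⟨max R₁ (∑ y ∈ S, ‖φ y‖), le_max_left _ _, fun y hy => (hT _ _).2 ?_⟩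
    exact (Finset.single_le_sum (f := fun y => ‖φ y‖) (fun _ _ => norm_nonneg _) hy).trans
      (le_max_right _ _)
  have b1 := hR₀ R₁ (le_max_left _ _)
  have b2 := hR₀ R₂ ((le_max_left _ _).trans hR₂)
  have c1 := Finset.sum_le_sum_of_subset_of_nonneg hS (f := fun y : ι => (1 : ℝ) / ((y : ℝ) ^ 2 - j ^ 2))
    (fun y _ hy => hpos y hy)
  have c2 := Finset.sum_le_sum_of_subset_of_nonneg hSR (f := fun y : ι => (1 : ℝ) / ((y : ℝ) ^ 2 - j ^ 2))
    (fun y _ hy => hpos y (fun h => hy (hS h)))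
  rw [Real.dist_eq, abs_lt]
  rw [abs_le] at b1 b2
  constructor <;> linarith [b1.1, b1.2, b2.1, b2.2]
end

section
/- For every positive integer k, the sum over all positive integers n with n ≠ k of 1/(n⁴ − k⁴) equals −(π/(4k³)) · coth(kπ) + 7/(8k⁴). -/
open Real

lemma aux_coth (k : ℕ) (hk : 0 < k) :
    HasSum (fun n : ℕ => 1 / (((n + 1 : ℕ) : ℝ) ^ 2 + (k : ℝ) ^ 2))
      (π / (2 * k) * (Real.cosh (k * π) / Real.sinh (k * π)) - 1 / (2 * (k : ℝ) ^ 2)) := by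
  have hk' : (0 : ℝ) < k := by exact_mod_cast hk
  have hkc : (k : ℂ) ≠ 0 := by exact_mod_cast hk.ne'
  have hs : Summable (fun n : ℕ => 1 / (((n + 1 : ℕ) : ℝ) ^ 2 + (k : ℝ) ^ 2)) := by
    have h := (summable_nat_add_iff 1).2 (Real.summable_one_div_nat_pow.2 (one_lt_two))
    refine Summable.of_nonneg_of_le (fun n => by positivity) (fun n => ?_) h
    apply one_div_le_one_div_of_le
    · positivity
    · nlinarith
  have hx : ((k : ℂ) * Complex.I) ∈ Complex.integerComplement := by
    rintro ⟨m, hm⟩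
    have := congrArg Complex.im hm
    simp at this
    exact hk.ne (by exact_mod_cast this)
  have h := cot_series_rep' hx
  have hsh : Real.sinh (k * π) ≠ 0 := by
    rw [Ne, Real.sinh_eq_zero]; positivity
  have hcot : Complex.cot (π * ((k : ℂ) * Complex.I)) =
      -Complex.I * ((Real.cosh (k * π) / Real.sinh (k * π) : ℝ) : ℂ) := by
    have hsc : Complex.sinh (k * π) ≠ 0 := by exact_mod_cast hsh
    rw [← mul_assoc, mul_comm (π : ℂ), Complex.cot, Complex.cos_mul_I, Complex.sin_mul_I]
    push_cast
    have := Complex.I_sq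
    field_simp
    linear_combination (Complex.cosh (k * π)) * this
  have ht : (∑' n : ℕ, (1 / ((k : ℂ) * Complex.I - (n + 1)) + 1 / ((k : ℂ) * Complex.I + (n + 1))))
      = (-2 * Complex.I * k) * ((∑' n : ℕ, 1 / (((n + 1 : ℕ) : ℝ) ^ 2 + (k : ℝ) ^ 2) : ℝ) : ℂ) := by
    rw [Complex.ofReal_tsum, ← tsum_mul_left]
    congr 1
    ext n
    have e1 : (k : ℂ) * Complex.I - (n + 1) ≠ 0 := fun h => by
      have := congrArg Complex.im h
      simp at this
      omega
    have e2 : (k : ℂ) * Complex.I + (n + 1) ≠ 0 := fun h => by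
      have := congrArg Complex.im h
      simp at this
      omega
    have e3 : ((n : ℂ) + 1) ^ 2 + (k : ℂ) ^ 2 ≠ 0 := by
      have : ((n : ℝ) + 1) ^ 2 + (k : ℝ) ^ 2 ≠ 0 := by positivity
      exact_mod_cast this
    push_cast
    rw [div_add_div _ _ e1 e2, mul_one_div, div_eq_div_iff (mul_ne_zero e1 e2) e3]
    linear_combination (2 * Complex.I * k ^ 3) * Complex.I_sq
  rw [hs.hasSum_iff]
  rw [ht, hcot] at h
  generalize (∑' n : ℕ, 1 / (((n + 1 : ℕ) : ℝ) ^ 2 + (k : ℝ) ^ 2)) = S at *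
  generalize (Real.cosh (k * π) / Real.sinh (k * π)) = C at *
  have h2 : (π * C - 1 / k : ℝ) = 2 * k * S := by
    have h3 : ((π * C - 1 / k : ℝ) : ℂ) = ((2 * k * S : ℝ) : ℂ) := by
      push_cast
      rw [one_div, mul_inv, Complex.inv_I] at h
      have hI := Complex.I_sq
      rw [one_div]
      linear_combination Complex.I * h + (π * C - (k : ℂ)⁻¹ - 2 * k * S) * hI
    exact_mod_cast h3
  field_simp at h2 ⊢
  linarith

lemma aux_tele (a : ℕ → ℝ) (m N : ℕ) :
    ∑ n ∈ Finset.range N, (a n - a (n + m)) =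
      ∑ j ∈ Finset.range m, a j - ∑ j ∈ Finset.range m, a (N + j) := by
  rw [Finset.sum_sub_distrib]
  have h1 := Finset.sum_range_add a N m
  have h2 := Finset.sum_range_add a m N
  rw [add_comm m N] at h2
  simp only [add_comm m] at h2
  linarith

lemma aux_g (k : ℕ) (hk : 0 < k) :
    HasSum (fun n : ℕ => 1 / ((n : ℝ) - k) - 1 / ((n : ℝ) + k)) (-1 / (k : ℝ)) := by
  have hk' : (0 : ℝ) < k := by exact_mod_cast hk
  have hs : Summable (fun n : ℕ => 1 / ((n : ℝ) - k) - 1 / ((n : ℝ) + k)) := by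
    have h := (Real.summable_one_div_nat_pow.2 (one_lt_two)).mul_left (4 * (k : ℝ))
    refine Summable.of_norm_bounded_eventually_nat h ?_
    filter_upwards [Filter.eventually_ge_atTop (2 * k)] with n hn
    have hn' : (2 : ℝ) * k ≤ n := by exact_mod_cast hn
    have p1 : (0 : ℝ) < n - k := by linarith
    have p2 : (0 : ℝ) < n + k := by linarith
    have p3 : (0 : ℝ) < n := by linarith
    have e : 1 / ((n : ℝ) - k) - 1 / ((n : ℝ) + k) = 2 * k / ((n - k) * (n + k)) := by
      field_simp
      ring
    rw [e, Real.norm_of_nonneg (by positivity), mul_one_div, div_le_div_iff₀ (by positivity) (by positivity)]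
    have : (n : ℝ) ^ 2 ≤ 2 * ((n - k) * (n + k)) := by nlinarith
    nlinarith
  rw [hs.hasSum_iff_tendsto_nat]
  set a : ℕ → ℝ := fun j => 1 / ((j : ℝ) - k) with ha
  have e : ∀ N : ℕ, ∑ n ∈ Finset.range N, (1 / ((n : ℝ) - k) - 1 / ((n : ℝ) + k)) =
      ∑ j ∈ Finset.range (2 * k), a j - ∑ j ∈ Finset.range (2 * k), a (N + j) := by
    intro N
    rw [← aux_tele]
    refine Finset.sum_congr rfl fun n _ => ?_
    simp only [ha]
    push_cast
    congr 2
    ring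
  have e0 : ∑ j ∈ Finset.range (2 * k), a j = -1 / k := by
    obtain ⟨m, hm⟩ : ∃ m, 2 * k = m + 1 := ⟨2 * k - 1, by omega⟩
    have hm' : (2 : ℝ) * k = m + 1 := by exact_mod_cast hm
    rw [hm, Finset.sum_range_succ']
    have hr := Finset.sum_range_reflect (fun j => a (j + 1)) m
    have : ∑ j ∈ Finset.range m, a (m - 1 - j + 1) = ∑ j ∈ Finset.range m, -a (j + 1) := by
      refine Finset.sum_congr rfl fun j hj => ?_
      have hj := Finset.mem_range.1 hj
      have : m - 1 - j + 1 = m - j := by omega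
      rw [this]
      simp only [ha]
      rw [Nat.cast_sub hj.le, ← one_div_neg_eq_neg_one_div]
      congr 1
      push_cast
      linarith
    rw [Finset.sum_neg_distrib] at this
    have z : ∑ j ∈ Finset.range m, a (j + 1) = 0 := by linarith
    rw [z]
    simp [ha, neg_div]
  simp_rw [e, e0]
  have lim : Filter.Tendsto (fun N : ℕ => ∑ j ∈ Finset.range (2 * k), a (N + j)) Filter.atTop (nhds 0) := by
    rw [← Finset.sum_const_zero (s := Finset.range (2 * k))]
    refine tendsto_finsetSum _ fun j _ => ?_
    have : Filter.Tendsto a Filter.atTop (nhds 0) := by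
      simp only [ha, one_div]
      exact tendsto_inv_atTop_zero.comp
        (Filter.tendsto_atTop_add_const_right _ (-(k : ℝ)) tendsto_natCast_atTop_atTop)
    exact this.comp (Filter.tendsto_add_atTop_nat j)
  simpa using lim.const_sub (-1 / (k : ℝ))

theorem quartic_integer_sum_coth (k : ℕ) (hk : 0 < k) :
    ∑' n : {n : ℕ // 0 < n ∧ n ≠ k}, (1 : ℝ) / ((n : ℝ) ^ 4 - (k : ℝ) ^ 4)
      = -(π / (4 * (k : ℝ) ^ 3)) * (Real.cosh (k * π) / Real.sinh (k * π))
        + 7 / (8 * (k : ℝ) ^ 4) := by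
  have hk' : (0 : ℝ) < k := by exact_mod_cast hk
  have h1 := aux_coth k hk
  have h1' := (hasSum_nat_add_iff (f := fun n : ℕ => 1 / ((n : ℝ) ^ 2 + (k : ℝ) ^ 2)) 1).1 h1
  have h2 := aux_g k hk
  have h3 := hasSum_ite_eq k (3 / (8 * (k : ℝ) ^ 4))
  have h4 := hasSum_ite_eq (0 : ℕ) (1 / (k : ℝ) ^ 4)
  have H := (((h2.mul_left (1 / (4 * (k : ℝ) ^ 3))).sub
    (h1'.mul_left (1 / (2 * (k : ℝ) ^ 2)))).add h3).add h4
  have hind := tsum_subtype {n : ℕ | 0 < n ∧ n ≠ k} (fun n : ℕ => (1 : ℝ) / ((n : ℝ) ^ 4 - (k : ℝ) ^ 4))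
  refine hind.trans ?_
  have hfun : ({n : ℕ | 0 < n ∧ n ≠ k}.indicator (fun n : ℕ => (1 : ℝ) / ((n : ℝ) ^ 4 - (k : ℝ) ^ 4)))
     = fun n : ℕ => 1 / (4 * (k : ℝ) ^ 3) * (1 / ((n : ℝ) - k) - 1 / ((n : ℝ) + k)) -
        1 / (2 * (k : ℝ) ^ 2) * (1 / ((n : ℝ) ^ 2 + (k : ℝ) ^ 2))
        + (if n = k then 3 / (8 * (k : ℝ) ^ 4) else 0) + (if n = 0 then 1 / (k : ℝ) ^ 4 else 0) := by
    ext n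
    rw [Set.indicator_apply]
    by_cases hnk : n = k
    · subst hnk
      simp [hk.ne']
      field_simp
      norm_num
    · by_cases hn0 : n = 0
      · subst hn0
        simp [hk.ne]
        field_simp
        norm_num
      · have p : (0 : ℝ) < n := by exact_mod_cast Nat.pos_of_ne_zero hn0
        have q : (n : ℝ) - k ≠ 0 := sub_ne_zero.2 (by exact_mod_cast hnk)
        have e : (n : ℝ) ^ 4 - (k : ℝ) ^ 4 = (n - k) * (n + k) * (n ^ 2 + k ^ 2) := by ring
        rw [if_pos ⟨Nat.pos_of_ne_zero hn0, hnk⟩, if_neg hnk, if_neg hn0, e]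
        field_simp
        ring
  rw [hfun, H.tsum_eq]
  generalize (Real.cosh (k * π) / Real.sinh (k * π)) = C at *
  simp
  field_simp
  ring
end

section
/- For every odd positive integer k, the sum over all odd positive integers n with n ≠ k of 1/(n⁴ − k⁴) equals −(π/(8k³)) · tanh(kπ/2) + 3/(8k⁴). -/
open Real

noncomputable def FF (j : ℕ) (m : ℕ) : ℝ := ∑ i ∈ Finset.range (2*j+1), 1 / ((m:ℝ) - j + i)

lemma FF_step (j m : ℕ) : FF j m - FF j (m+1) = 1/((m:ℝ)-j) - 1/((m:ℝ)+j+1) := by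
  have := Finset.sum_range_sub' (fun i : ℕ => 1 / ((m:ℝ) - j + i)) (2*j+1)
  simp only [FF, ← Finset.sum_sub_distrib]
  rw [← sub_eq_zero, ← sub_eq_zero.mpr this] 
  push_cast
  ring_nf

lemma FF_zero (j : ℕ) : FF j 0 = 0 := by
  have := Finset.sum_range_reflect (fun i : ℕ => 1 / (((0:ℕ):ℝ) - j + i)) (2*j+1)
  have h2 : ∑ i ∈ Finset.range (2*j+1), 1 / (((0:ℕ):ℝ) - j + ((2*j+1-1-i : ℕ):ℝ)) = - FF j 0 := by
    rw [FF, ← Finset.sum_neg_distrib]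
    apply Finset.sum_congr rfl
    intro i hi
    have hi' : i ≤ 2*j := by simp at hi; omega
    rw [← one_div_neg_eq_neg_one_div, show 2*j+1-1-i = 2*j - i by omega, Nat.cast_sub hi']
    congr 1
    push_cast; ring
  simp only [FF] at *
  linarith

lemma FF_lim (j : ℕ) : Filter.Tendsto (FF j) Filter.atTop (nhds 0) := by
  have : ∀ i ∈ Finset.range (2*j+1), Filter.Tendsto (fun m : ℕ => 1 / ((m:ℝ) - j + i)) Filter.atTop (nhds 0) := by
    intro i _
    simp only [one_div]
    apply Filter.Tendsto.inv_tendsto_atTop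
    apply Filter.tendsto_atTop_add_const_right
    exact Filter.tendsto_atTop_add_const_right _ _ tendsto_natCast_atTop_atTop
  have := tendsto_finsetSum _ this
  have e : FF j = fun m : ℕ => ∑ i ∈ Finset.range (2*j+1), 1 / ((m:ℝ) - j + i) := rfl
  rw [e]
  simpa using this

lemma f_hasSum (j : ℕ) : HasSum (fun m : ℕ => 1/((m:ℝ)-j) - 1/((m:ℝ)+j+1)) 0 := by
  rw [← hasSum_nat_add_iff' (j+1)]
  have hs : ∀ N, ∑ i ∈ Finset.range N, (1/((i:ℝ)-j) - 1/((i:ℝ)+j+1)) = - FF j N := by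
    intro N
    simp_rw [← FF_step]
    rw [Finset.sum_range_sub', FF_zero]; ring
  rw [hasSum_iff_tendsto_nat_of_nonneg]
  · have h1 : ∀ N, ∑ i ∈ Finset.range N, (1/(((i+(j+1):ℕ):ℝ)-j) - 1/(((i+(j+1):ℕ):ℝ)+j+1)) = FF j (j+1) - FF j (N + (j+1)) := by
      intro N
      simp_rw [← FF_step]
      have := Finset.sum_range_sub' (fun i => FF j (i+(j+1))) N
      simp only [zero_add] at this
      rw [← this]
      apply Finset.sum_congr rfl
      intro i _
      rw [show i + (j+1) + 1 = i + 1 + (j+1) by ring]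
    simp_rw [h1, hs]
    have := ((Filter.tendsto_add_atTop_iff_nat (j+1)).mpr (FF_lim j)).const_sub (FF j (j+1))
    simpa using this
  · intro i
    push_cast
    rw [sub_nonneg]
    apply one_div_le_one_div_of_le
    · ring_nf; positivity
    · have : (0:ℝ) ≤ j := by positivity
      linarith

lemma hsc {E : Type*} [AddCommMonoid E] [TopologicalSpace E] {f g : ℕ → E} {a b : E}
    (h : HasSum f a) (hf : ∀ n, g n = f n) (hb : b = a) : HasSum g b := by
  rw [hb, funext hf]; exact h

lemma S_all (y : ℝ) (hy : 0 < y) : HasSum (fun n : ℕ => 1 / ((n+1:ℝ)^2 + y^2))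
   ((π * y * (Real.cosh (π*y) / Real.sinh (π*y)) - 1) / (2*y^2)) := by
  have hz : (y * Complex.I : ℂ) ∈ Complex.integerComplement := by
    rintro ⟨n, hn⟩
    have := congrArg Complex.im hn
    simp at this
    exact hy.ne this
  have h := (summable_cotTerm hz).hasSum
  have hsum : ∑' n, cotTerm (y * Complex.I : ℂ) n = _ := (cot_series_rep' hz).symm
  rw [hsum] at h
  have hyc : (y:ℂ) ≠ 0 := by exact_mod_cast hy.ne'
  have hsh : Complex.sinh (π * y) ≠ 0 := by
    have : Real.sinh (π * y) ≠ 0 := (Real.sinh_pos_iff.mpr (by positivity)).ne'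
    exact_mod_cast this
  have h2 := h.mul_left (Complex.I / (2 * y))
  rw [← Complex.hasSum_ofReal]
  refine hsc h2 ?_ ?_
  · intro n
    rw [cotTerm_identity hz]
    have e : (y * Complex.I + (n+1)) * (y * Complex.I - (n+1)) = -((n+1:ℂ)^2 + y^2) := by
      linear_combination (y:ℂ)^2 * Complex.I_sq
    rw [e]
    have : ((n+1:ℂ)^2 + y^2) ≠ 0 := by
      have : ((n+1:ℝ)^2 + y^2) ≠ 0 := by positivity
      exact_mod_cast this
    push_cast
    field_simp
    linear_combination Complex.I_sq
  · rw [Complex.cot_eq_cos_div_sin, ← mul_assoc, Complex.sin_mul_I, Complex.cos_mul_I]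
    push_cast
    have := Complex.I_ne_zero
    field_simp
    

lemma S_odd (y : ℝ) (hy : 0 < y) : HasSum (fun n : ℕ => 1 / ((2*n+1:ℝ)^2 + y^2))
   (π / (4*y) * Real.tanh (y * π / 2)) := by
  have h1 := S_all y hy
  have h2 := (S_all (y/2) (by positivity)).mul_left (1/4)
  have hs : Summable (fun n : ℕ => 1 / ((2*n+1:ℝ)^2 + y^2)) := by
    have := h1.summable.comp_injective (i := fun m : ℕ => 2 * m) (fun a b h => by simpa using h)
    refine this.congr fun n => ?_
    simp
  have h3 := hs.hasSum
  have he := HasSum.even_add_odd (f := fun n : ℕ => 1 / ((n+1:ℝ)^2 + y^2)) (m := ∑' n : ℕ, 1 / ((2*n+1:ℝ)^2 + y^2))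
    (m' := _) (hsc h3 (fun n => by push_cast; ring) rfl) (hsc h2 (fun n => by
      have : ((n:ℝ)+1)^2 + (y/2)^2 ≠ 0 := by positivity
      rw [one_div_mul_one_div]
      push_cast
      congr 1
      ring) rfl)
  have hu := h1.unique he
  have hv : ∑' n : ℕ, 1 / ((2*n+1:ℝ)^2 + y^2) = π / (4*y) * Real.tanh (y * π / 2) := by
    rw [eq_comm, ← eq_sub_iff_add_eq] at hu
    rw [hu, Real.tanh_eq_sinh_div_cosh, show π * (y/2) = y*π/2 by ring,
      show π * y = 2 * (y*π/2) by ring, Real.sinh_two_mul, Real.cosh_two_mul]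
    have a : Real.sinh (y*π/2) ≠ 0 := (Real.sinh_pos_iff.mpr (by positivity)).ne'
    have b : Real.cosh (y*π/2) ≠ 0 := (Real.cosh_pos _).ne'
    generalize Real.sinh (y*π/2) = s at *
    generalize Real.cosh (y*π/2) = c at *
    field_simp
    ring
  rwa [hv] at h3

theorem quartic_odd_integer_sum_tanh (k : ℕ) (hk : 0 < k) (hodd : Odd k) :
    ∑' n : {n : ℕ // 0 < n ∧ Odd n ∧ n ≠ k}, (1 : ℝ) / ((n : ℝ) ^ 4 - (k : ℝ) ^ 4)
      = -(π / (8 * (k : ℝ) ^ 3)) * Real.tanh (k * π / 2)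
        + 3 / (8 * (k : ℝ) ^ 4) := by
  obtain ⟨j, hj⟩ := hodd
  have hk0 : (0:ℝ) < k := by exact_mod_cast hk
  have hkj : (k:ℝ) = 2*j+1 := by rw [hj]; push_cast; ring
  have hA := S_odd k hk0
  have hB := f_hasSum j
  have hC := (((hB.add (hasSum_ite_eq j (1/(k:ℝ)))).mul_left (1/(4*(k:ℝ)))).sub
    (hA.sub (hasSum_ite_eq j (1/(2*(k:ℝ)^2))))).mul_left (1/(2*(k:ℝ)^2))
  have hD : HasSum (fun m : ℕ => (1:ℝ) / ((((2*m+1 : ℕ) : ℝ)) ^ 4 - (k : ℝ) ^ 4))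
      (-(π / (8 * (k : ℝ) ^ 3)) * Real.tanh (k * π / 2) + 3 / (8 * (k : ℝ) ^ 4)) := by
    refine hsc hC ?_ ?_
    · intro m
      by_cases hm : m = j
      · subst hm
        simp only [if_true]
        push_cast
        rw [← hkj, sub_self, sub_self, show (m:ℝ)+m+1 = k by rw [hkj]; ring]
        field_simp
        ring
      · simp only [if_neg hm]
        have h1 : (m:ℝ) - j ≠ 0 := sub_ne_zero.mpr (by exact_mod_cast hm)
        have h2 : (m:ℝ) + j + 1 ≠ 0 := by positivity
        have h3 : (2*m+1:ℝ)^2 + k^2 ≠ 0 := by positivity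
        have e : (((2*m+1 : ℕ) : ℝ)) ^ 4 - (k : ℝ) ^ 4 = 4 * (m-j) * (m+j+1) * ((2*m+1:ℝ)^2 + k^2) := by
          rw [hkj]; push_cast; ring
        rw [e]
        have e2 : (1:ℝ)/(m-j) - 1/(m+j+1) = k / ((m-j)*(m+j+1)) := by
          rw [hkj]; field_simp; ring
        rw [e2]
        field_simp
        rw [hkj]
        ring
    · field_simp
      ring
  have inj : Function.Injective (fun m : ℕ => 2*m+1) := fun a b h => by simpa using h
  have hE : HasSum (fun n : ℕ => if Odd n then (1:ℝ) / ((n : ℝ) ^ 4 - (k : ℝ) ^ 4) else 0)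
      (-(π / (8 * (k : ℝ) ^ 3)) * Real.tanh (k * π / 2) + 3 / (8 * (k : ℝ) ^ 4)) := by
    rw [← inj.hasSum_iff]
    · convert hD using 1
      ext m
      simp
    · intro x hx
      rw [if_neg]
      rintro ⟨m, rfl⟩
      exact hx ⟨m, rfl⟩
  have hF := (hasSum_subtype_iff_of_support_subset (s := {n : ℕ | 0 < n ∧ Odd n ∧ n ≠ k}) (by
    intro n hn
    rw [Function.mem_support] at hn
    by_cases ho : Odd n
    · refine ⟨ho.pos, ho, ?_⟩
      rintro rfl
      simp at hn
    · simp [ho] at hn)).mpr hE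
  rw [← hF.tsum_eq]
  apply tsum_congr
  rintro ⟨n, hn⟩
  simp [hn.2.1]
end
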